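/- In the universal enveloping algebra U of gl(N,ℂ), for every 1 ≤ n ≤ N−1 and every λ ∈ ℂ, the quantum minor 𝒞_n(λ) equals the commutator [E_{n+1,n}, 𝒜_n(λ)] = E_{n+1,n}·𝒜_n(λ) − 𝒜_n(λ)·E_{n+1,n}. -/

import Mathlib

open Finset

noncomputable section

attribute [local instance 100] LieRing.ofAssociativeRing

/-- The universal enveloping algebra of `gl(N, ℂ)`. -/
abbrev UEA (N : ℕ) := UniversalEnvelopingAlgebra ℂ (Matrix (Fin N) (Fin N) ℂ)

/-- The image `E_{ab}` in the universal enveloping algebra of the matrix unit `e_{ab}`. -/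
def Egen (N : ℕ) (a b : Fin N) : UEA N :=
  UniversalEnvelopingAlgebra.ι ℂ (Matrix.single a b 1)

/-- The quantum minor `qdet_{r,c}(λ) = Σ_{p ∈ S_n} sgn(p) ∏_{k=1}^{n}
((λ − iℏρ_k^{(n)})·δ_{r_{p(k)},c_k}·1 − iℏ·E_{r_{p(k)},c_k})`, the noncommutative
product taken in increasing order of `k`, with `ρ_k^{(n)} = (n − 2k + 1)/2`. -/
def qdet (ℏ : ℂ) (N n : ℕ) (r c : Fin n → Fin N) (lam : ℂ) : UEA N :=
  ∑ p : Equiv.Perm (Fin n),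
    ((Equiv.Perm.sign p : ℤ) : ℂ) •
      ((List.finRange n).map (fun (k : Fin n) =>
        (algebraMap ℂ (UEA N))
            ((lam - Complex.I * ℏ * (((n : ℂ) - 2 * (((k : ℕ) : ℂ) + 1) + 1) / 2)) *
              (if r (p k) = c k then 1 else 0)) -
          (Complex.I * ℏ) • Egen N (r (p k)) (c k))).prod

/-- If `x` commutes with every `f k` for `k ≠ j` and `⁅x, f j⁆ = g j`, where `g` agrees with `f`
away from `j`, then the commutator of `x` with an ordered product of the `f k` over a list
without repetitions containing `j` is the corresponding product of the `g k`. -/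
theorem commutator_list_prod_of_mem {A ι : Type*} [Ring A] (x : A) (f g : ι → A) (j : ι)
    (hfg : ∀ k, k ≠ j → f k = g k) (hcomm : ∀ k, k ≠ j → x * f k = f k * x)
    (hj : x * f j - f j * x = g j) (l : List ι) (hl : l.Nodup) (hmem : j ∈ l) :
    x * (l.map f).prod - (l.map f).prod * x = (l.map g).prod := by
  induction l with
  | nil => simp at hmem
  | cons a l ih =>
    obtain ⟨ha, hl'⟩ := List.nodup_cons.mp hl
    simp only [List.map_cons, List.prod_cons]
    by_cases haj : a = j
    · subst haj
      have hne : ∀ k ∈ l, k ≠ a := fun k hk h => ha (h ▸ hk)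
      have hmap : l.map g = l.map f := List.map_congr_left fun k hk => (hfg k (hne k hk)).symm
      have hc : Commute x (l.map f).prod := by
        refine Commute.list_prod_right _ _ fun y hy => ?_
        obtain ⟨k, hk, rfl⟩ := List.mem_map.mp hy
        exact hcomm k (hne k hk)
      rw [hmap, ← hj, sub_mul, mul_assoc (f a) _ x, ← hc.eq]
      simp only [mul_assoc]
    · have hjl : j ∈ l := (List.mem_cons.mp hmem).resolve_left (Ne.symm haj)
      rw [← ih hl' hjl, ← hfg a haj, mul_sub, ← mul_assoc x, hcomm a haj]
      simp only [mul_assoc]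

/-- The commutation relations of the generators `E_{ab}`. -/
theorem Egen_commutator (N : ℕ) (a b c d : Fin N) :
    Egen N a b * Egen N c d - Egen N c d * Egen N a b =
      (if b = c then Egen N a d else 0) - (if d = a then Egen N c b else 0) := by
  have h : Egen N a b * Egen N c d - Egen N c d * Egen N a b =
      UniversalEnvelopingAlgebra.ι ℂ
        ⁅(Matrix.single a b 1 : Matrix (Fin N) (Fin N) ℂ), Matrix.single c d 1⁆ := by
    rw [LieHom.map_lie, LieRing.of_associative_ring_bracket]
    rfl
  rw [h, LieRing.of_associative_ring_bracket, map_sub]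
  congr 1
  · split_ifs with hbc
    · subst hbc
      rw [Matrix.single_mul_single_same, mul_one]
      rfl
    · rw [Matrix.single_mul_single_of_ne _ _ _ _ hbc, map_zero]
  · split_ifs with hda
    · subst hda
      rw [Matrix.single_mul_single_same, mul_one]
      rfl
    · rw [Matrix.single_mul_single_of_ne _ _ _ _ hda, map_zero]

/-- Commutator of `E_{ab}`, `a ≠ d`, with a matrix entry `z·1 − w·E_{cd}`. -/
theorem Egen_commutator_entry (N : ℕ) (a b c d : Fin N) (had : d ≠ a) (z w : ℂ) :
    Egen N a b * (algebraMap ℂ (UEA N) z - w • Egen N c d) -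
        (algebraMap ℂ (UEA N) z - w • Egen N c d) * Egen N a b =
      if b = c then -(w • Egen N a d) else 0 := by
  have h := Egen_commutator N a b c d
  rw [if_neg had, sub_zero] at h
  have key : Egen N a b * (algebraMap ℂ (UEA N) z - w • Egen N c d) -
        (algebraMap ℂ (UEA N) z - w • Egen N c d) * Egen N a b =
      -(w • (Egen N a b * Egen N c d - Egen N c d * Egen N a b)) := by
    rw [mul_sub, sub_mul, ← Algebra.commutes z, mul_smul_comm, smul_mul_assoc, smul_sub]
    abel
  rw [key, h]
  split_ifs <;> simp

/-- If `a` is not a column index and the rows are distinct, the commutator of `E_{a, r_j}` with a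
quantum minor replaces the row index `r_j` by `a`. -/
theorem commutator_qdet (ℏ : ℂ) (N n : ℕ) (r c : Fin n → Fin N) (lam : ℂ) (a : Fin N) (j : Fin n)
    (hr : Function.Injective r) (hc : ∀ k, c k ≠ a) :
    Egen N a (r j) * qdet ℏ N n r c lam - qdet ℏ N n r c lam * Egen N a (r j) =
      qdet ℏ N n (Function.update r j a) c lam := by
  unfold qdet
  rw [Finset.mul_sum, Finset.sum_mul, ← Finset.sum_sub_distrib]
  refine Finset.sum_congr rfl fun p _ => ?_
  rw [mul_smul_comm, smul_mul_assoc, ← smul_sub]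
  congr 1
  refine commutator_list_prod_of_mem _ _ _ (p.symm j) (fun k hk => ?_) (fun k hk => ?_) ?_ _
    (List.nodup_finRange n) (List.mem_finRange _)
  · rw [Function.update_of_ne fun h => hk (by simp [← h])]
  · refine sub_eq_zero.mp ?_
    rw [Egen_commutator_entry _ _ _ _ _ (hc k), if_neg]
    exact fun h => hk (by simp [hr h])
  · rw [Egen_commutator_entry _ _ _ _ _ (hc _)]
    simp [(hc _).symm]

/-- the quantum minor `𝒞_n(λ)` (rows `1,…,n−1,n+1`, columns `1,…,n`)
equals the commutator `[E_{n+1,n}, 𝒜_n(λ)]`, where `𝒜_n(λ)` is the principal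
quantum minor (rows and columns `1,…,n`). -/
theorem qminor_C_eq_commutator (ℏ : ℂ) (N : ℕ) (hN : 2 ≤ N)
    (n : ℕ) (hn1 : 1 ≤ n) (hn : n ≤ N - 1) (lam : ℂ) :
    qdet ℏ N n
        (fun k => if (k : ℕ) + 1 = n then (⟨n, by omega⟩ : Fin N) else Fin.castLE (by omega) k)
        (fun k => Fin.castLE (by omega) k) lam =
      Egen N ⟨n, by omega⟩ ⟨n - 1, by omega⟩ *
          qdet ℏ N n (fun k => Fin.castLE (by omega) k) (fun k => Fin.castLE (by omega) k) lam -
        qdet ℏ N n (fun k => Fin.castLE (by omega) k) (fun k => Fin.castLE (by omega) k) lam *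
          Egen N ⟨n, by omega⟩ ⟨n - 1, by omega⟩ := by
  have h := commutator_qdet ℏ N n (fun k => Fin.castLE (by omega) k)
    (fun k => Fin.castLE (by omega) k) lam ⟨n, by omega⟩ ⟨n - 1, by omega⟩
    (Fin.castLE_injective (by omega)) (fun k hk => k.isLt.ne (congrArg Fin.val hk))
  refine Eq.trans ?_ h.symm
  congr 1
  funext k
  have hk : (k : ℕ) + 1 = n ↔ k = ⟨n - 1, by omega⟩ := by
    rw [Fin.ext_iff]
    exact ⟨fun h => by dsimp only; omega, fun h => by dsimp only at h; omega⟩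
  simp only [Function.update_apply, hk]
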